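/- Let P be a polynomial with complex coefficients of degree n, let a be a complex number with |a| ≤ 1, and let β be a complex number with |β| ≤ 1. Then for every complex z with |z| ≥ 1, |z·((1+az)P″(z) − (n−1)a·P′(z)) + (n/2)·β·((1+az)P′(z) − n·a·P(z)) + P′(z)| ≤ n·|1 + β/2| · n|z|^(n−1) · max_{|w|=1} |P(w)|. -/

import Mathlib

open Polynomial

/-- The modified Smirnov operator: S̃ₐ[P](z) = (1+az)·P′(z) − n·a·P(z). -/
noncomputable def smirnov (n : ℕ) (a : ℂ) (P : Polynomial ℂ) (z : ℂ) : ℂ :=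
  (1 + a * z) * P.derivative.eval z - (n : ℂ) * a * P.eval z

/-- The maximum of ‖P‖ on the unit circle. -/
noncomputable def maxCircle (P : Polynomial ℂ) : ℝ :=
  sSup {y : ℝ | ∃ w : ℂ, ‖w‖ = 1 ∧ y = ‖P.eval w‖}

/-- The average of a nonempty multiset of points of a convex set lies in the set. -/
theorem Convex.multiset_average_mem {s : Set ℂ} (hs : Convex ℝ s) (m : Multiset ℂ)
    (hm : m ≠ 0) (h : ∀ v ∈ m, v ∈ s) : m.sum / (m.card : ℂ) ∈ s := by
  induction m using Multiset.induction_on with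
  | empty => exact absurd rfl hm
  | cons x t ih =>
    rcases eq_or_ne t 0 with rfl | ht
    · simpa using h
    · have hx : x ∈ s := h x (Multiset.mem_cons_self x t)
      have hv := ih ht fun v hv => h v (Multiset.mem_cons_of_mem hv)
      have hcard : 0 < t.card := Multiset.card_pos.2 ht
      have hpos : (0 : ℝ) < t.card + 1 := by positivity
      have hne : (t.card : ℂ) ≠ 0 := by exact_mod_cast hcard.ne'
      have hne' : (t.card : ℂ) + 1 ≠ 0 := by exact_mod_cast hpos.ne'
      convert hs hx hv (a := 1 / ((t.card : ℝ) + 1)) (b := t.card / ((t.card : ℝ) + 1))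
        (by positivity) (by positivity) (by field_simp; ring) using 1
      simp only [Multiset.sum_cons, Multiset.card_cons, Complex.real_smul]
      push_cast
      field_simp

theorem norm_mul_sub_one_lt_norm_iff (z v : ℂ) :
    ‖z * v - 1‖ < ‖v‖ ↔
      (‖z‖ ^ 2 - 1) * (v.re ^ 2 + v.im ^ 2) - 2 * (z.re * v.re - z.im * v.im) + 1 < 0 := by
  rw [← sq_lt_sq₀ (norm_nonneg _) (norm_nonneg _), Complex.sq_norm, Complex.sq_norm,
    Complex.sq_norm, Complex.normSq_apply, Complex.normSq_apply, Complex.normSq_apply, ← sub_neg]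
  simp only [Complex.sub_re, Complex.mul_re, Complex.one_re, Complex.sub_im, Complex.mul_im,
    Complex.one_im]
  ring_nf

/-- For `1 ≤ ‖z‖`, the image of the open unit disc under `r ↦ (z - r)⁻¹` is convex. -/
theorem convex_setOf_norm_mul_sub_one_lt {z : ℂ} (hz : 1 ≤ ‖z‖) :
    Convex ℝ {v : ℂ | ‖z * v - 1‖ < ‖v‖} := by
  intro v hv w hw s t hs ht hst
  simp only [Set.mem_ofPred_eq, norm_mul_sub_one_lt_norm_iff] at hv hw ⊢
  simp only [Complex.add_re, Complex.add_im, Complex.real_smul, Complex.re_ofReal_mul,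
    Complex.im_ofReal_mul]
  have hk : 0 ≤ ‖z‖ ^ 2 - 1 := by nlinarith
  generalize ‖z‖ ^ 2 - 1 = k at *
  obtain rfl : t = 1 - s := by linarith
  have hcross : 0 ≤ s * (1 - s) * (k * ((v.re - w.re) ^ 2 + (v.im - w.im) ^ 2)) := by positivity
  rcases hs.eq_or_lt with rfl | hs
  · simpa using hw
  · nlinarith [mul_neg_of_pos_of_neg hs hv, mul_nonpos_of_nonneg_of_nonpos ht hw.le]

/-- A form of Laguerre's theorem: if all zeros of `F` lie in the open unit disc, then outside that
disc the normalized logarithmic derivative of `F` is `(z - c)⁻¹` for some `c` in the disc. -/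
theorem exists_eval_derivative_eq {n : ℕ} (hn : n ≠ 0) {F : ℂ[X]} (hF : F.natDegree = n)
    (hroots : ∀ w : ℂ, 1 ≤ ‖w‖ → F.eval w ≠ 0) {z : ℂ} (hz : 1 ≤ ‖z‖) :
    ∃ v : ℂ, ‖z * v - 1‖ < ‖v‖ ∧ F.derivative.eval z = n * v * F.eval z := by
  have hsplit := IsAlgClosed.splits F
  have hcard : F.roots.card = n := by rw [← hsplit.natDegree_eq_card_roots, hF]
  have hne : (n : ℂ) ≠ 0 := Nat.cast_ne_zero.2 hn
  refine ⟨F.derivative.eval z / F.eval z / n, ?_, ?_⟩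
  · rw [hsplit.eval_derivative_div_eval_of_ne_zero (hroots z hz), ← hcard,
      ← Multiset.card_map (fun r => 1 / (z - r)) F.roots]
    refine (convex_setOf_norm_mul_sub_one_lt hz).multiset_average_mem _ ?_ ?_
    · rw [← Multiset.card_pos, Multiset.card_map, hcard]
      exact Nat.pos_of_ne_zero hn
    · intro v hv
      obtain ⟨r, hr, rfl⟩ := Multiset.mem_map.1 hv
      have hr1 : ‖r‖ < 1 := by
        by_contra! h
        exact hroots r h (isRoot_of_mem_roots hr)
      have hzr : z - r ≠ 0 := by
        rintro h
        rw [sub_eq_zero.1 h] at hz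
        exact absurd hz (not_le.2 hr1)
      have heq : z * (1 / (z - r)) - 1 = r * (1 / (z - r)) := by
        field_simp
        ring
      rw [Set.mem_ofPred_eq, heq, norm_mul]
      exact mul_lt_of_lt_one_left (norm_pos_iff.2 (one_div_ne_zero hzr)) hr1
  · field_simp [hroots z hz]

theorem half_lt_norm_of_norm_sub_one_lt {w : ℂ} (h : ‖w - 1‖ < ‖w‖) : 1 / 2 < ‖w‖ := by
  have := norm_sub_le w (w - 1)
  rw [sub_sub_cancel, norm_one] at this
  linarith

theorem one_add_half_ne_zero {β : ℂ} (hβ : ‖β‖ ≤ 1) : 1 + β / 2 ≠ 0 := by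
  intro h
  have : β = -2 := by linear_combination 2 * h
  norm_num [this] at hβ

theorem coeff_X_mul_derivative_add (F : ℂ[X]) (c : ℂ) (k : ℕ) :
    (X * derivative F + C c * F).coeff k = (k + c) * F.coeff k := by
  cases k
  · simp
  · simp [coeff_X_mul, coeff_derivative]
    ring

theorem natDegree_X_mul_derivative_add {n : ℕ} (hn : n ≠ 0) {F : ℂ[X]} (hF : F.natDegree = n)
    {β : ℂ} (hβ : ‖β‖ ≤ 1) :
    (X * derivative F + C ((n : ℂ) / 2 * β) * F).natDegree = n := by
  have hne : (n : ℂ) ≠ 0 := Nat.cast_ne_zero.2 hn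
  have hF0 : F ≠ 0 := by
    rintro rfl
    exact hn (by simpa using hF.symm)
  refine natDegree_eq_of_le_of_coeff_ne_zero (natDegree_le_iff_coeff_eq_zero.2 fun k hk => ?_) ?_
  · rw [coeff_X_mul_derivative_add, coeff_eq_zero_of_natDegree_lt (hF ▸ hk), mul_zero]
  · rw [coeff_X_mul_derivative_add]
    refine mul_ne_zero ?_ ?_
    · rw [show (n : ℂ) + n / 2 * β = n * (1 + β / 2) by ring]
      exact mul_ne_zero hne (one_add_half_ne_zero hβ)
    · rw [← hF]
      exact leadingCoeff_ne_zero.2 hF0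

theorem eval_X_mul_derivative_add_ne_zero {n : ℕ} (hn : n ≠ 0) {F : ℂ[X]} (hF : F.natDegree = n)
    (hroots : ∀ w : ℂ, 1 ≤ ‖w‖ → F.eval w ≠ 0) {β : ℂ} (hβ : ‖β‖ ≤ 1) {z : ℂ} (hz : 1 ≤ ‖z‖) :
    (X * derivative F + C ((n : ℂ) / 2 * β) * F).eval z ≠ 0 := by
  obtain ⟨v, hv, hd⟩ := exists_eval_derivative_eq hn hF hroots hz
  have hzv : 1 / 2 < ‖z * v‖ := by
    refine half_lt_norm_of_norm_sub_one_lt (hv.trans_le ?_)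
    rw [norm_mul]
    exact le_mul_of_one_le_left (norm_nonneg v) hz
  have hsum : z * v + β / 2 ≠ 0 := by
    intro h
    rw [eq_neg_of_add_eq_zero_left h, norm_neg, norm_div, Complex.norm_ofNat] at hzv
    linarith
  have : (X * derivative F + C ((n : ℂ) / 2 * β) * F).eval z
      = n * F.eval z * (z * v + β / 2) := by
    simp only [eval_add, eval_mul, eval_X, eval_C, hd]
    ring
  rw [this]
  exact mul_ne_zero (mul_ne_zero (Nat.cast_ne_zero.2 hn) (hroots z hz)) hsum

theorem smirnov_ne_zero {n : ℕ} (hn : n ≠ 0) {G : ℂ[X]} (hG : G.natDegree = n)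
    (hroots : ∀ w : ℂ, 1 ≤ ‖w‖ → G.eval w ≠ 0) {a : ℂ} (ha : ‖a‖ ≤ 1) {z : ℂ} (hz : 1 ≤ ‖z‖) :
    smirnov n a G z ≠ 0 := by
  obtain ⟨v, hv, hd⟩ := exists_eval_derivative_eq hn hG hroots hz
  have hsum : v + a * (z * v - 1) ≠ 0 := by
    intro h
    rw [eq_neg_of_add_eq_zero_left h, norm_neg, norm_mul, ← eq_neg_of_add_eq_zero_left h] at hv
    exact absurd hv (not_lt.2 (mul_le_of_le_one_left (norm_nonneg _) ha))
  have : smirnov n a G z = n * G.eval z * (v + a * (z * v - 1)) := by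
    rw [smirnov, hd]
    ring
  rw [this]
  exact mul_ne_zero (mul_ne_zero (Nat.cast_ne_zero.2 hn) (hroots z hz)) hsum

theorem norm_eval_le_maxCircle (P : ℂ[X]) {w : ℂ} (hw : ‖w‖ = 1) :
    ‖P.eval w‖ ≤ maxCircle P := by
  have hbdd : BddAbove ((fun w => ‖P.eval w‖) '' Metric.sphere (0 : ℂ) 1) :=
    (isCompact_sphere 0 1).bddAbove_image P.continuous.norm.continuousOn
  refine le_csSup (hbdd.mono ?_) ⟨w, hw, rfl⟩
  rintro _ ⟨u, hu, rfl⟩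
  exact ⟨u, by simpa using hu, rfl⟩

theorem eval_reverse_mul_pow (P : ℂ[X]) {z : ℂ} (hz : z ≠ 0) :
    P.reverse.eval z⁻¹ * z ^ P.natDegree = P.eval z := by
  let := invertibleOfNonzero hz
  simpa only [invOf_eq_inv, eval₂_id] using eval₂_reverse_mul_pow (RingHom.id ℂ) z P

theorem norm_eval_reverse_le_maxCircle (P : ℂ[X]) {w : ℂ} (hw : ‖w‖ ≤ 1) :
    ‖P.reverse.eval w‖ ≤ maxCircle P := by
  refine Complex.norm_le_of_forall_mem_frontier_norm_le (U := Metric.ball 0 1)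
    Metric.isBounded_ball (f := fun w => P.reverse.eval w) P.reverse.differentiable.diffContOnCl
    (fun u hu => ?_) (by simpa [closure_ball] using hw)
  have hu1 : ‖u‖ = 1 := by simpa [frontier_ball] using hu
  have hu0 : u ≠ 0 := norm_ne_zero_iff.1 (by simp [hu1])
  have heval := congrArg norm (eval_reverse_mul_pow P (inv_ne_zero hu0))
  rw [inv_inv, norm_mul, norm_pow, norm_inv, hu1, inv_one, one_pow, mul_one] at heval
  rw [heval]
  exact norm_eval_le_maxCircle P (by rw [norm_inv, hu1, inv_one])

theorem norm_eval_le_maxCircle_mul_pow (P : ℂ[X]) {z : ℂ} (hz : 1 ≤ ‖z‖) :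
    ‖P.eval z‖ ≤ maxCircle P * ‖z‖ ^ P.natDegree := by
  have hz0 : z ≠ 0 := norm_pos_iff.1 (by linarith)
  rw [← eval_reverse_mul_pow P hz0, norm_mul, norm_pow]
  gcongr
  exact norm_eval_reverse_le_maxCircle P (by rw [norm_inv]; exact inv_le_one_of_one_le₀ hz)

theorem norm_leadingCoeff_le_maxCircle (P : ℂ[X]) : ‖P.leadingCoeff‖ ≤ maxCircle P := by
  rw [← coeff_zero_reverse, coeff_zero_eq_eval_zero]
  exact norm_eval_reverse_le_maxCircle P (by simp)

theorem eval_sub_C_mul_X_pow_ne_zero {P : ℂ[X]} {μ : ℂ} (hμ : maxCircle P < ‖μ‖) {z : ℂ}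
    (hz : 1 ≤ ‖z‖) : (P - C μ * X ^ P.natDegree).eval z ≠ 0 := by
  intro h
  simp only [eval_sub, eval_mul, eval_C, eval_pow, eval_X, sub_eq_zero] at h
  have hle := norm_eval_le_maxCircle_mul_pow P hz
  rw [h, norm_mul, norm_pow] at hle
  have hpos : 0 < ‖z‖ ^ P.natDegree := by positivity
  exact absurd (le_of_mul_le_mul_right hle hpos) (not_le.2 hμ)

theorem natDegree_sub_C_mul_X_pow {P : ℂ[X]} {μ : ℂ} (hμ : maxCircle P < ‖μ‖) :
    (P - C μ * X ^ P.natDegree).natDegree = P.natDegree := by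
  refine natDegree_eq_of_le_of_coeff_ne_zero
    ((natDegree_sub_le_of_le le_rfl (natDegree_C_mul_X_pow_le _ _)).trans (max_self _).le) ?_
  rw [coeff_sub, coeff_C_mul_X_pow, if_pos rfl, sub_ne_zero]
  rintro h
  rw [← h] at hμ
  exact absurd (norm_leadingCoeff_le_maxCircle P) (not_le.2 hμ)

theorem statement1 (n : ℕ) (P : Polynomial ℂ) (hP : P.natDegree = n)
    (a β : ℂ) (ha : ‖a‖ ≤ 1) (hβ : ‖β‖ ≤ 1)
    (z : ℂ) (hz : 1 ≤ ‖z‖) :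
    ‖z * ((1 + a * z) * P.derivative.derivative.eval z
          - ((n - 1 : ℕ) : ℂ) * a * P.derivative.eval z)
        + ((n : ℂ) / 2) * β * ((1 + a * z) * P.derivative.eval z - (n : ℂ) * a * P.eval z)
        + P.derivative.eval z‖
      ≤ (n : ℝ) * ‖1 + β / 2‖ * ((n : ℝ) * ‖z‖ ^ (n - 1)) * maxCircle P := by
  rcases Nat.eq_zero_or_pos n with rfl | hn
  · rw [natDegree_eq_zero] at hP
    obtain ⟨c, rfl⟩ := hP
    simp
  by_contra! hlt
  obtain ⟨m, rfl⟩ : ∃ m, n = m + 1 := ⟨n - 1, by omega⟩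
  simp only [Nat.add_sub_cancel] at hlt
  set A : ℂ := z * ((1 + a * z) * P.derivative.derivative.eval z
        - (m : ℂ) * a * P.derivative.eval z)
      + (((m + 1 : ℕ) : ℂ) / 2) * β
        * ((1 + a * z) * P.derivative.eval z - ((m + 1 : ℕ) : ℂ) * a * P.eval z)
      + P.derivative.eval z with hA
  have hz0 : z ≠ 0 := norm_pos_iff.1 (by linarith)
  have hn0 : ((m + 1 : ℕ) : ℂ) ≠ 0 := Nat.cast_ne_zero.2 (by omega)
  set B : ℂ := ((m + 1 : ℕ) : ℂ) * (1 + β / 2) * (((m + 1 : ℕ) : ℂ) * z ^ m) with hB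
  have hB0 : B ≠ 0 :=
    mul_ne_zero (mul_ne_zero hn0 (one_add_half_ne_zero hβ)) (mul_ne_zero hn0 (pow_ne_zero _ hz0))
  have hμ : maxCircle P < ‖A / B‖ := by
    rw [norm_div, lt_div_iff₀ (norm_pos_iff.2 hB0), mul_comm]
    simpa only [hB, norm_mul, norm_pow, Complex.norm_natCast] using hlt
  have hdeg := natDegree_sub_C_mul_X_pow hμ
  have hroots : ∀ w : ℂ, 1 ≤ ‖w‖ → _ := fun w hw => eval_sub_C_mul_X_pow_ne_zero hμ hw
  rw [hP] at hdeg hroots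
  refine smirnov_ne_zero m.succ_ne_zero
    (natDegree_X_mul_derivative_add m.succ_ne_zero hdeg hβ)
    (fun w hw => eval_X_mul_derivative_add_ne_zero m.succ_ne_zero hdeg hroots hβ hw) ha hz ?_
  have hAB : A / B * B = A := div_mul_cancel₀ A hB0
  generalize A / B = μ at hAB
  rw [smirnov]
  simp only [derivative_add, derivative_mul, derivative_sub, derivative_C, derivative_X,
    derivative_X_pow, eval_add, eval_sub, eval_mul, eval_C, eval_X, eval_pow, eval_zero,
    eval_one, derivative_zero, Nat.add_sub_cancel]
  have hpow : z * ((m : ℂ) * z ^ (m - 1)) = m * z ^ m := by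
    cases m <;> simp [pow_succ']; ring
  rw [hA, hB] at hAB
  push_cast at hAB ⊢
  linear_combination -hAB - μ * (m + 1) * (1 + a * z) * hpow
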